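/- Let H : E × E × ℝ → ℝ be C¹ with (∂H/∂u)(x,p,u) ≥ λ for some λ > 0 and all (x,p,u). If z : ℝ → E × E × ℝ is a solution of the contact Hamiltonian ODE associated to H defined on all of ℝ whose range is contained in a compact set, then H(z(t)) = 0 for all t ∈ ℝ. -/

import Mathlib

open scoped RealInnerProductSpace

noncomputable def pgradX {n : ℕ}
    (H : EuclideanSpace ℝ (Fin n) × EuclideanSpace ℝ (Fin n) × ℝ → ℝ)
    (z : EuclideanSpace ℝ (Fin n) × EuclideanSpace ℝ (Fin n) × ℝ) :
    EuclideanSpace ℝ (Fin n) :=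
  gradient (fun x => H (x, z.2.1, z.2.2)) z.1

noncomputable def pgradP {n : ℕ}
    (H : EuclideanSpace ℝ (Fin n) × EuclideanSpace ℝ (Fin n) × ℝ → ℝ)
    (z : EuclideanSpace ℝ (Fin n) × EuclideanSpace ℝ (Fin n) × ℝ) :
    EuclideanSpace ℝ (Fin n) :=
  gradient (fun p => H (z.1, p, z.2.2)) z.2.1

noncomputable def pderivU {n : ℕ}
    (H : EuclideanSpace ℝ (Fin n) × EuclideanSpace ℝ (Fin n) × ℝ → ℝ)
    (z : EuclideanSpace ℝ (Fin n) × EuclideanSpace ℝ (Fin n) × ℝ) : ℝ :=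
  deriv (fun u => H (z.1, z.2.1, u)) z.2.2

/-- `z = (x,p,u)` solves the contact Hamiltonian ODE associated to `H` on `I`. -/
def IsContactSol {n : ℕ}
    (H : EuclideanSpace ℝ (Fin n) × EuclideanSpace ℝ (Fin n) × ℝ → ℝ)
    (I : Set ℝ) (x p : ℝ → EuclideanSpace ℝ (Fin n)) (u : ℝ → ℝ) : Prop :=
  ∀ t ∈ I,
    HasDerivAt x (pgradP H (x t, p t, u t)) t ∧
    HasDerivAt p (-pgradX H (x t, p t, u t) - pderivU H (x t, p t, u t) • p t) t ∧
    HasDerivAt u (⟪pgradP H (x t, p t, u t), p t⟫ - H (x t, p t, u t)) t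

/-- The partial derivatives recover the total derivative of `H`. -/
theorem fderiv_apply_eq_partials {n : ℕ}
    {H : EuclideanSpace ℝ (Fin n) × EuclideanSpace ℝ (Fin n) × ℝ → ℝ}
    {z : EuclideanSpace ℝ (Fin n) × EuclideanSpace ℝ (Fin n) × ℝ}
    (hH : DifferentiableAt ℝ H z) (a b : EuclideanSpace ℝ (Fin n)) (c : ℝ) :
    fderiv ℝ H z (a, b, c) = ⟪pgradX H z, a⟫ + ⟪pgradP H z, b⟫ + pderivU H z * c := by
  obtain ⟨x, p, u⟩ := z
  have hX : HasFDerivAt (fun y => H (y, p, u)) _ x :=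
    hH.hasFDerivAt.comp x (hasFDerivAt_prodMk_left x (p, u))
  have hP : HasFDerivAt (fun y => H (x, y, u)) _ p :=
    hH.hasFDerivAt.comp p
      ((hasFDerivAt_prodMk_right x (p, u)).comp p (hasFDerivAt_prodMk_left p u))
  have hU : HasDerivAt (fun y => H (x, p, y)) _ u :=
    hH.hasFDerivAt.comp_hasDerivAt u
      ((hasDerivAt_const u x).prodMk ((hasDerivAt_const u p).prodMk (hasDerivAt_id u)))
  have eX : ⟪pgradX H (x, p, u), a⟫ = fderiv ℝ H (x, p, u) (a, 0, 0) := by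
    simp only [pgradX, gradient, InnerProductSpace.toDual_symm_apply, hX.fderiv]
    rfl
  have eP : ⟪pgradP H (x, p, u), b⟫ = fderiv ℝ H (x, p, u) (0, b, 0) := by
    simp only [pgradP, gradient, InnerProductSpace.toDual_symm_apply, hP.fderiv]
    rfl
  have eU : pderivU H (x, p, u) * c = fderiv ℝ H (x, p, u) (0, 0, c) := by
    simp only [pderivU, hU.deriv]
    rw [mul_comm, ← smul_eq_mul, ← map_smul]
    simp
  rw [eX, eP, eU, ← map_add, ← map_add]
  simp

/-- Along a solution, the Hamiltonian satisfies `h' = -(∂H/∂u) h`. -/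
theorem IsContactSol.hasDerivAt_hamiltonian {n : ℕ}
    {H : EuclideanSpace ℝ (Fin n) × EuclideanSpace ℝ (Fin n) × ℝ → ℝ}
    {I : Set ℝ} {x p : ℝ → EuclideanSpace ℝ (Fin n)} {u : ℝ → ℝ}
    (hsol : IsContactSol H I x p u) {t : ℝ} (ht : t ∈ I)
    (hH : DifferentiableAt ℝ H (x t, p t, u t)) :
    HasDerivAt (fun s => H (x s, p s, u s))
      (-(pderivU H (x t, p t, u t) * H (x t, p t, u t))) t := by
  obtain ⟨hx, hp, hu⟩ := hsol t ht
  have h := hH.hasFDerivAt.comp_hasDerivAt t (hx.prodMk (hp.prodMk hu))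
  refine h.congr_deriv ?_
  rw [fderiv_apply_eq_partials hH, inner_sub_right, inner_neg_right, inner_smul_right,
    real_inner_comm (pgradX H _)]
  ring

/-- A bounded function on `ℝ` with `h' = -a h`, where `a` is bounded below by a positive
constant, vanishes identically. -/
theorem eq_zero_of_hasDerivAt_neg_mul_of_bounded {h a : ℝ → ℝ} {c M : ℝ} (hc : 0 < c)
    (ha : ∀ t, c ≤ a t) (hh : ∀ t, HasDerivAt h (-(a t * h t)) t) (hM : ∀ t, |h t| ≤ M) (t : ℝ) :
    h t = 0 := by
  have hd : ∀ s, HasDerivAt (fun s => Real.exp (2 * c * s) * h s ^ 2)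
      (2 * (c - a s) * (Real.exp (2 * c * s) * h s ^ 2)) s := fun s => by
    have he : HasDerivAt (fun s => Real.exp (2 * c * s)) (Real.exp (2 * c * s) * (2 * c)) s := by
      simpa using ((hasDerivAt_id s).const_mul (2 * c)).exp
    refine (he.mul ((hh s).pow 2)).congr_deriv ?_
    simp
    ring
  have hanti : Antitone fun s => Real.exp (2 * c * s) * h s ^ 2 :=
    antitone_of_hasDerivAt_nonpos hd fun s =>
      mul_nonpos_of_nonpos_of_nonneg (by linarith [ha s]) (by positivity)
  have hlim : Filter.Tendsto (fun s => Real.exp (2 * c * s) * M ^ 2) Filter.atBot (nhds 0) := by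
    simpa using (Real.tendsto_exp_atBot.comp
      (Filter.tendsto_id.const_mul_atBot (by positivity : 0 < 2 * c))).mul_const (M ^ 2)
  have hle : Real.exp (2 * c * t) * h t ^ 2 ≤ 0 := by
    refine ge_of_tendsto hlim ?_
    filter_upwards [Filter.eventually_le_atBot t] with s hs
    refine (hanti hs).trans ?_
    exact mul_le_mul_of_nonneg_left
      (sq_le_sq' (abs_le.1 (hM s)).1 (abs_le.1 (hM s)).2) (Real.exp_pos _).le
  have hsq : h t ^ 2 ≤ 0 := nonpos_of_mul_nonpos_right hle (Real.exp_pos _)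
  exact pow_eq_zero_iff two_ne_zero |>.1 (le_antisymm hsq (sq_nonneg _))

theorem stmt_11 {n : ℕ} (hn : 1 ≤ n)
    (H : EuclideanSpace ℝ (Fin n) × EuclideanSpace ℝ (Fin n) × ℝ → ℝ) (hH : ContDiff ℝ 1 H)
    (lam : ℝ) (hlam : 0 < lam) (hmono : ∀ z, lam ≤ pderivU H z)
    (x p : ℝ → EuclideanSpace ℝ (Fin n)) (u : ℝ → ℝ)
    (hsol : IsContactSol H Set.univ x p u)
    (C : Set (EuclideanSpace ℝ (Fin n) × EuclideanSpace ℝ (Fin n) × ℝ)) (hC : IsCompact C)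
    (hrange : ∀ t : ℝ, (x t, p t, u t) ∈ C) :
    ∀ t : ℝ, H (x t, p t, u t) = 0 := by
  obtain ⟨M, hM⟩ := hC.exists_bound_of_continuousOn hH.continuous.continuousOn
  exact eq_zero_of_hasDerivAt_neg_mul_of_bounded hlam
    (fun t => hmono (x t, p t, u t))
    (fun t => hsol.hasDerivAt_hamiltonian (Set.mem_univ t)
      (hH.differentiable one_ne_zero).differentiableAt)
    (fun t => hM _ (hrange t))
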